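/- Let p_0 ∈ ℝ and let ψ : (0,∞) → ℝ satisfy |ψ(s)| ≤ 1 for all s > 0 and the functional equation ψ(s) = p_0 + ψ(s+θ1)·H_1(s) + ψ(s+θ2)·H_2(s) for all s > 0. Then for every s > 0 the series c(s) = Σ_{i≥0} Σ_{j≥0} c_{i,j}(s) converges and ψ(s) = p_0·c(s). -/

import Mathlib

open MeasureTheory
open scoped ENNReal

/-- The Laplace–Stieltjes transform `G̃(s) = ∫ e^{-sx} dν(x)`. -/
noncomputable def Gtil (ν : Measure ℝ) (s : ℝ) : ℝ := ∫ x, Real.exp (-s * x) ∂ν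

/-- `H(s) = λ(1 - G̃(s))/s`. -/
noncomputable def Hfun (l : ℝ) (ν : Measure ℝ) (s : ℝ) : ℝ := l * (1 - Gtil ν s) / s


lemma Hfun_bounds_aux (l : ℝ) (hl : 0 < l) (ν : Measure ℝ) [IsProbabilityMeasure ν]
    (hν : ν (Set.Iio 0) = 0) (s : ℝ) (hs : 0 < s) :
    0 ≤ Hfun l ν s ∧ Hfun l ν s ≤ l / s := by
  have hae : ∀ᵐ x ∂ν, 0 ≤ x := by
    rw [ae_iff]
    have : {a : ℝ | ¬ 0 ≤ a} = Set.Iio 0 := by ext; simp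
    rw [this, hν]
  have h0 : 0 ≤ Gtil ν s := integral_nonneg fun x => (Real.exp_pos _).le
  have hle : ∀ᵐ x ∂ν, ‖Real.exp (-s * x)‖ ≤ 1 := by
    filter_upwards [hae] with x hx
    rw [Real.norm_eq_abs, abs_of_pos (Real.exp_pos _)]
    apply Real.exp_le_one_iff.mpr
    nlinarith
  have h1 : Gtil ν s ≤ 1 := by
    have := norm_integral_le_of_norm_le_const hle
    simp only [probReal_univ, mul_one] at this
    exact (le_abs_self _).trans this
  unfold Hfun
  constructor
  · apply div_nonneg _ hs.le
    exact mul_nonneg hl.le (by linarith)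
  · apply div_le_div_of_nonneg_right _ hs.le
    nlinarith

lemma hasSum_antidiag_aux (a : ℕ × ℕ → ℝ) (ha : ∀ q, 0 ≤ a q) (T : ℝ)
    (h : HasSum (fun n => ∑ q ∈ Finset.HasAntidiagonal.antidiagonal n, a q) T) : HasSum a T := by
  have hsum : Summable a := by
    rw [← (Finset.HasAntidiagonal.sigmaAntidiagonalEquivProd (A := ℕ)).summable_iff]
    refine (summable_sigma_of_nonneg (fun z => ha _)).mpr ?_
    refine ⟨fun n => Summable.of_finite, ?_⟩
    convert h.summable using 2 with n
    rw [tsum_fintype]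
    exact Finset.sum_coe_sort (Finset.HasAntidiagonal.antidiagonal n) a
  have h2 := (Finset.HasAntidiagonal.sigmaAntidiagonalEquivProd (A := ℕ)).hasSum_iff.mpr hsum.hasSum
  have h3 := h2.sigma (g := fun n => ∑ q ∈ Finset.HasAntidiagonal.antidiagonal n, a q) (fun n => by
    have := hasSum_fintype (fun q : Finset.HasAntidiagonal.antidiagonal n => a q)
    rw [Finset.sum_coe_sort (Finset.HasAntidiagonal.antidiagonal n) a] at this
    exact this)
  rw [h.unique h3]
  exact hsum.hasSum

/-- If `|ψ(s)| ≤ 1` for `s > 0` and `ψ(s) = p₀ + ψ(s+θ1)H_1(s) + ψ(s+θ2)H_2(s)` for all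
`s > 0`, then for every `s > 0` the series `c(s) = Σ_{i,j≥0} c_{i,j}(s)` converges and
`ψ(s) = p₀·c(s)`. -/
theorem psi_eq_p0_mul_c
    (l1 l2 t1 t2 : ℝ) (hl1 : 0 < l1) (hl2 : 0 < l2) (ht1 : 0 < t1) (ht2 : 0 < t2)
    (ν1 ν2 : Measure ℝ) [IsProbabilityMeasure ν1] [IsProbabilityMeasure ν2]
    (hν1 : ν1 (Set.Iio 0) = 0) (hν2 : ν2 (Set.Iio 0) = 0)
    (c : ℤ → ℤ → ℝ → ℝ)
    (hc00 : ∀ s : ℝ, c 0 0 s = 1)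
    (hcneg : ∀ (i j : ℤ) (s : ℝ), i < 0 ∨ j < 0 → c i j s = 0)
    (hcrec : ∀ (i j : ℤ), 0 ≤ i → 0 ≤ j → 0 < i + j → ∀ s : ℝ,
      c i j s =
        Hfun l1 ν1 (s + ((i : ℝ) - 1) * t1 + (j : ℝ) * t2) * c (i - 1) j s
          + Hfun l2 ν2 (s + (i : ℝ) * t1 + ((j : ℝ) - 1) * t2) * c i (j - 1) s)
    (p0 : ℝ) (ψ : ℝ → ℝ)
    (hbd : ∀ s : ℝ, 0 < s → |ψ s| ≤ 1)
    (heq : ∀ s : ℝ, 0 < s →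
      ψ s = p0 + ψ (s + t1) * Hfun l1 ν1 s + ψ (s + t2) * Hfun l2 ν2 s) :
    ∀ s : ℝ, 0 < s →
      Summable (fun q : ℕ × ℕ => c (q.1 : ℤ) (q.2 : ℤ) s) ∧
      ψ s = p0 * ∑' q : ℕ × ℕ, c (q.1 : ℤ) (q.2 : ℤ) s := by
  intro s hs
  set x : ℕ × ℕ → ℝ := fun q => s + q.1 * t1 + q.2 * t2 with hx
  set a : ℕ × ℕ → ℝ := fun q => c (q.1 : ℤ) (q.2 : ℤ) s with ha
  have hxpos : ∀ q, 0 < x q := fun q => by simp only [hx]; positivity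
  have H1 := fun q => Hfun_bounds_aux l1 hl1 ν1 hν1 (x q) (hxpos q)
  have H2 := fun q => Hfun_bounds_aux l2 hl2 ν2 hν2 (x q) (hxpos q)
  have key : ∀ (f : ℕ × ℕ → ℝ) (n : ℕ),
      ∑ q ∈ Finset.HasAntidiagonal.antidiagonal (n + 1), a q * f q =
      ∑ q ∈ Finset.HasAntidiagonal.antidiagonal n, a q * (Hfun l1 ν1 (x q) * f (q.1 + 1, q.2)
        + Hfun l2 ν2 (x q) * f (q.1, q.2 + 1)) := by
    intro f n
    have e1 : ∀ q ∈ Finset.HasAntidiagonal.antidiagonal (n + 1), a q * f q =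
        Hfun l1 ν1 (s + ((q.1 : ℝ) - 1) * t1 + (q.2 : ℝ) * t2) * c ((q.1 : ℤ) - 1) q.2 s * f q
        + Hfun l2 ν2 (s + (q.1 : ℝ) * t1 + ((q.2 : ℝ) - 1) * t2) * c q.1 ((q.2 : ℤ) - 1) s
          * f q := by
      intro q hq
      rw [Finset.HasAntidiagonal.mem_antidiagonal] at hq
      have := hcrec q.1 q.2 (by positivity) (by positivity) (by omega) s
      simp only [Int.cast_natCast] at this
      simp only [ha]
      rw [this]
      ring
    rw [Finset.sum_congr rfl e1, Finset.sum_add_distrib,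
      Finset.Nat.sum_antidiagonal_succ, Finset.Nat.sum_antidiagonal_succ']
    simp only [Nat.cast_zero]
    rw [hcneg (0 - 1) _ s (Or.inl (by norm_num)), hcneg _ (0 - 1) s (Or.inr (by norm_num))]
    simp only [mul_zero, zero_mul, zero_add, add_zero]
    rw [← Finset.sum_add_distrib]
    refine Finset.sum_congr rfl fun q _ => ?_
    simp only [hx, ha, Nat.cast_add, Nat.cast_one, add_sub_cancel_right]
    ring
  have hapos : ∀ n : ℕ, ∀ q : ℕ × ℕ, q.1 + q.2 = n → 0 ≤ a q := by
    intro n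
    induction n with
    | zero =>
      rintro ⟨i, j⟩ h
      obtain ⟨rfl, rfl⟩ : i = 0 ∧ j = 0 := by simpa using h
      simp [ha, hc00]
    | succ n ih =>
      intro q hq
      have h := key (fun p => if p = q then 1 else 0) n
      simp only [mul_ite, mul_one, mul_zero] at h
      rw [Finset.sum_ite_eq' , if_pos (Finset.HasAntidiagonal.mem_antidiagonal.mpr hq)] at h
      rw [h]
      refine Finset.sum_nonneg fun p hp => mul_nonneg (ih p (Finset.HasAntidiagonal.mem_antidiagonal.mp hp)) ?_
      have := (H1 p).1
      have := (H2 p).1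
      apply add_nonneg <;> split_ifs <;> simp_all
  have hanon : ∀ q, 0 ≤ a q := fun q => hapos _ q rfl
  set S : ℕ → ℝ := fun n => ∑ q ∈ Finset.HasAntidiagonal.antidiagonal n, a q with hS
  have hSnon : ∀ n, 0 ≤ S n := fun n => Finset.sum_nonneg fun q _ => hanon q
  have hSrec : ∀ n, S (n + 1) = ∑ q ∈ Finset.HasAntidiagonal.antidiagonal n,
      a q * (Hfun l1 ν1 (x q) + Hfun l2 ν2 (x q)) := by
    intro n
    simpa using key (fun _ => 1) n
  have hSsum : Summable S := by
    apply summable_of_ratio_norm_eventually_le (r := 1 / 2) (by norm_num)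
    set t := min t1 t2 with ht
    have htpos : 0 < t := lt_min ht1 ht2
    obtain ⟨N, hN⟩ := exists_nat_ge (2 * (l1 + l2) / t)
    filter_upwards [Filter.eventually_ge_atTop N] with n hn
    rw [Real.norm_of_nonneg (hSnon _), Real.norm_of_nonneg (hSnon _), hSrec, hS, Finset.mul_sum]
    refine Finset.sum_le_sum fun q hq => ?_
    rw [Finset.HasAntidiagonal.mem_antidiagonal] at hq
    rw [mul_comm]
    refine mul_le_mul_of_nonneg_right ?_ (hanon q)
    have hb : 2 * (l1 + l2) ≤ x q := by
      rw [div_le_iff₀ htpos] at hN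
      have h1 : (N : ℝ) ≤ q.1 + q.2 := by exact_mod_cast hq ▸ hn
      have h2 : (N : ℝ) * t ≤ (q.1 + q.2) * t := mul_le_mul_of_nonneg_right h1 htpos.le
      have h3 : (q.1 : ℝ) * t ≤ q.1 * t1 :=
        mul_le_mul_of_nonneg_left (min_le_left _ _) (Nat.cast_nonneg _)
      have h4 : (q.2 : ℝ) * t ≤ q.2 * t2 :=
        mul_le_mul_of_nonneg_left (min_le_right _ _) (Nat.cast_nonneg _)
      simp only [hx]
      nlinarith
    have h5 : l1 / x q + l2 / x q ≤ 1 / 2 := by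
      rw [← add_div, div_le_iff₀ (hxpos q)]
      linarith
    linarith [(H1 q).2, (H2 q).2]
  set R : ℕ → ℝ := fun n => ∑ q ∈ Finset.HasAntidiagonal.antidiagonal n, a q * ψ (x q) with hR
  have hRrec : ∀ n, R n = p0 * S n + R (n + 1) := by
    intro n
    have h := key (fun q => ψ (x q)) n
    simp only [hR, hS]
    rw [h, Finset.mul_sum, ← Finset.sum_add_distrib]
    refine Finset.sum_congr rfl fun q _ => ?_
    have e1 : x (q.1 + 1, q.2) = x q + t1 := by simp only [hx]; push_cast; ring
    have e2 : x (q.1, q.2 + 1) = x q + t2 := by simp only [hx]; push_cast; ring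
    rw [e1, e2, heq (x q) (hxpos q)]
    ring
  have hRlim : Filter.Tendsto R Filter.atTop (nhds 0) := by
    refine squeeze_zero_norm (fun n => ?_) hSsum.tendsto_atTop_zero
    refine (norm_sum_le _ _).trans (Finset.sum_le_sum fun q _ => ?_)
    rw [norm_mul, Real.norm_of_nonneg (hanon q), Real.norm_eq_abs]
    exact mul_le_of_le_one_right (hanon q) (hbd _ (hxpos q))
  have hR0 : R 0 = ψ s := by simp [hR, ha, hx, hc00]
  have hpart : ∀ n, ψ s = p0 * ∑ k ∈ Finset.range n, S k + R n := by
    intro n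
    induction n with
    | zero => simp [hR0]
    | succ n ih => rw [ih, Finset.sum_range_succ, hRrec n]; ring
  have hlim := (hSsum.hasSum.tendsto_sum_nat.const_mul p0).add hRlim
  have hfin : ψ s = p0 * ∑' n, S n := by
    have h := tendsto_nhds_unique (tendsto_const_nhds.congr hpart) hlim
    rw [h, add_zero]
  have hA := hasSum_antidiag_aux a hanon _ hSsum.hasSum
  exact ⟨hA.summable, by rw [hA.tsum_eq]; exact hfin⟩
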